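/- arXiv:2003.03963 — 3 statements merged into one kernel-verified Lean document; each statement's English description precedes it below -/
import Mathlib

section
/- Let X ∈ ℝ^{m×m} be symmetric, let a₁, b₁, ε₁ > 0, and let L₁ ≥ max{6/a₁, 2/b₁}. Define f(U,V) := (1/2)‖X − U V Uᵀ‖² and h₁(U,V) := (a₁/4)‖V‖²‖U‖⁴ + (b₁/2)(‖X‖‖V‖ + ε₁)‖U‖² (Frobenius norms). Then for every fixed V ∈ ℝ^{r×r}, the function U ↦ L₁·h₁(U,V) − f(U,V) is convex on ℝ^{m×r}. -/
open Matrix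

/-- The Frobenius inner product `⟨A, B⟩ = trace (Aᵀ B)`. -/
noncomputable def finner {m r : ℕ} (A B : Matrix (Fin m) (Fin r) ℝ) : ℝ :=
  (Aᵀ * B).trace

/-- The Frobenius norm `‖A‖ = √(trace (Aᵀ A))`. -/
noncomputable def fnorm {m r : ℕ} (A : Matrix (Fin m) (Fin r) ℝ) : ℝ :=
  Real.sqrt (Aᵀ * A).trace

theorem finner_eq_sum {m r : ℕ} (A B : Matrix (Fin m) (Fin r) ℝ) :
    finner A B = ∑ p : Fin m × Fin r, A p.1 p.2 * B p.1 p.2 := by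
  rw [Fintype.sum_prod_type, Finset.sum_comm]
  simp [finner, Matrix.trace, Matrix.mul_apply]

theorem finner_comm {m r : ℕ} (A B : Matrix (Fin m) (Fin r) ℝ) : finner A B = finner B A := by
  simp only [finner_eq_sum, mul_comm]

theorem finner_add_right {m r : ℕ} (A B C : Matrix (Fin m) (Fin r) ℝ) :
    finner A (B + C) = finner A B + finner A C := by
  simp [finner, Matrix.mul_add]

theorem finner_smul_right {m r : ℕ} (t : ℝ) (A B : Matrix (Fin m) (Fin r) ℝ) :
    finner A (t • B) = t * finner A B := by
  simp [finner]

theorem finner_sub_right {m r : ℕ} (A B C : Matrix (Fin m) (Fin r) ℝ) :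
    finner A (B - C) = finner A B - finner A C := by
  simp [finner, Matrix.mul_sub]

theorem finner_add_left {m r : ℕ} (A B C : Matrix (Fin m) (Fin r) ℝ) :
    finner (A + B) C = finner A C + finner B C := by
  simp [finner, Matrix.add_mul]

theorem finner_smul_left {m r : ℕ} (t : ℝ) (A B : Matrix (Fin m) (Fin r) ℝ) :
    finner (t • A) B = t * finner A B := by
  simp [finner]

theorem finner_sub_left {m r : ℕ} (A B C : Matrix (Fin m) (Fin r) ℝ) :
    finner (A - B) C = finner A C - finner B C := by
  simp [finner, Matrix.sub_mul]

theorem finner_self_nonneg {m r : ℕ} (A : Matrix (Fin m) (Fin r) ℝ) : 0 ≤ finner A A := by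
  rw [finner_eq_sum]
  exact Finset.sum_nonneg fun p _ => mul_self_nonneg _

theorem fnorm_nonneg {m r : ℕ} (A : Matrix (Fin m) (Fin r) ℝ) : 0 ≤ fnorm A :=
  Real.sqrt_nonneg _

theorem fnorm_sq {m r : ℕ} (A : Matrix (Fin m) (Fin r) ℝ) : fnorm A ^ 2 = finner A A :=
  Real.sq_sqrt (finner_self_nonneg A)

theorem abs_finner_le {m r : ℕ} (A B : Matrix (Fin m) (Fin r) ℝ) :
    |finner A B| ≤ fnorm A * fnorm B := by
  refine abs_le_of_sq_le_sq ?_ (mul_nonneg (fnorm_nonneg A) (fnorm_nonneg B))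
  rw [mul_pow, fnorm_sq, fnorm_sq, finner_eq_sum, finner_eq_sum, finner_eq_sum]
  simpa only [← sq] using Finset.sum_mul_sq_le_sq_mul_sq Finset.univ
    (fun p : Fin m × Fin r => A p.1 p.2) (fun p => B p.1 p.2)

section FrobeniusNorm

attribute [local instance] Matrix.frobeniusNormedAddCommGroup

theorem fnorm_eq_norm {m r : ℕ} (A : Matrix (Fin m) (Fin r) ℝ) : fnorm A = ‖A‖ := by
  rw [Matrix.frobenius_norm_def, ← Real.sqrt_eq_rpow]
  change √(finner A A) = _
  rw [finner_eq_sum, Fintype.sum_prod_type]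
  simp [sq]

theorem fnorm_add_le {m r : ℕ} (A B : Matrix (Fin m) (Fin r) ℝ) :
    fnorm (A + B) ≤ fnorm A + fnorm B := by
  simpa only [fnorm_eq_norm] using norm_add_le A B

theorem fnorm_mul_le {m r s : ℕ} (A : Matrix (Fin m) (Fin r) ℝ) (B : Matrix (Fin r) (Fin s) ℝ) :
    fnorm (A * B) ≤ fnorm A * fnorm B := by
  simpa only [fnorm_eq_norm] using Matrix.frobenius_norm_mul A B

theorem fnorm_transpose {m r : ℕ} (A : Matrix (Fin m) (Fin r) ℝ) : fnorm Aᵀ = fnorm A := by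
  simpa only [fnorm_eq_norm] using Matrix.frobenius_norm_transpose A

end FrobeniusNorm

theorem fnorm_mul_mul_transpose_le {m r : ℕ} (A B : Matrix (Fin m) (Fin r) ℝ)
    (V : Matrix (Fin r) (Fin r) ℝ) : fnorm (A * V * Bᵀ) ≤ fnorm A * fnorm V * fnorm B := by
  refine (fnorm_mul_le _ _).trans ?_
  rw [fnorm_transpose]
  exact mul_le_mul_of_nonneg_right (fnorm_mul_le _ _) (fnorm_nonneg _)

theorem convexOn_quartic (c₀ c₁ c₂ c₃ c₄ : ℝ)
    (h : ∀ t : ℝ, 0 ≤ 2 * c₂ + 6 * c₃ * t + 12 * c₄ * t ^ 2) :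
    ConvexOn ℝ Set.univ
      (fun t : ℝ => c₀ + c₁ * t + c₂ * t ^ 2 + c₃ * t ^ 3 + c₄ * t ^ 4) := by
  have h₁ : deriv (fun t : ℝ => c₀ + c₁ * t + c₂ * t ^ 2 + c₃ * t ^ 3 + c₄ * t ^ 4) =
      fun t => c₁ + 2 * c₂ * t + 3 * c₃ * t ^ 2 + 4 * c₄ * t ^ 3 := by
    funext t
    refine (((((hasDerivAt_const t c₀).add ((hasDerivAt_id t).const_mul c₁)).add
      ((hasDerivAt_pow 2 t).const_mul c₂)).add ((hasDerivAt_pow 3 t).const_mul c₃)).add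
      ((hasDerivAt_pow 4 t).const_mul c₄)).deriv.trans ?_
    norm_num
    ring
  have h₂ : deriv (fun t : ℝ => c₁ + 2 * c₂ * t + 3 * c₃ * t ^ 2 + 4 * c₄ * t ^ 3) =
      fun t => 2 * c₂ + 6 * c₃ * t + 12 * c₄ * t ^ 2 := by
    funext t
    refine ((((hasDerivAt_const t c₁).add ((hasDerivAt_id t).const_mul (2 * c₂))).add
      ((hasDerivAt_pow 2 t).const_mul (3 * c₃))).add
      ((hasDerivAt_pow 3 t).const_mul (4 * c₄))).deriv.trans ?_
    norm_num
    ring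
  refine convexOn_univ_of_deriv2_nonneg (by fun_prop) (by rw [h₁]; fun_prop) fun t => ?_
  simpa only [Function.iterate_succ, Function.iterate_zero, Function.comp_apply, id, h₁, h₂]
    using h t

/-- Upper bound for the second derivative of `U ↦ (1/2)‖X − U V Uᵀ‖²` in the direction `D`. -/
theorem second_variation_le {m r : ℕ} (X : Matrix (Fin m) (Fin m) ℝ)
    (V : Matrix (Fin r) (Fin r) ℝ) (U D : Matrix (Fin m) (Fin r) ℝ) :
    finner (D * V * Uᵀ + U * V * Dᵀ) (D * V * Uᵀ + U * V * Dᵀ)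
        - 2 * finner (X - U * V * Uᵀ) (D * V * Dᵀ)
      ≤ 6 * (fnorm V ^ 2 * fnorm U ^ 2 * fnorm D ^ 2)
        + 2 * (fnorm X * fnorm V * fnorm D ^ 2) := by
  have hS : fnorm (D * V * Uᵀ + U * V * Dᵀ) ≤ 2 * (fnorm U * fnorm V * fnorm D) := by
    linarith [fnorm_add_le (D * V * Uᵀ) (U * V * Dᵀ), fnorm_mul_mul_transpose_le D U V,
      fnorm_mul_mul_transpose_le U D V]
  have hS2 := pow_le_pow_left₀ (fnorm_nonneg _) hS 2
  rw [fnorm_sq] at hS2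
  have hDD := fnorm_mul_mul_transpose_le D D V
  have hX := (neg_abs_le _).trans' (neg_le_neg ((abs_finner_le X (D * V * Dᵀ)).trans
    (mul_le_mul_of_nonneg_left hDD (fnorm_nonneg _))))
  have hU := (le_abs_self _).trans ((abs_finner_le (U * V * Uᵀ) (D * V * Dᵀ)).trans
    (mul_le_mul (fnorm_mul_mul_transpose_le U U V) hDD (fnorm_nonneg _)
      (mul_nonneg (mul_nonneg (fnorm_nonneg _) (fnorm_nonneg _)) (fnorm_nonneg _))))
  rw [finner_sub_left]
  linarith

/-- Block relative smoothness of the SymTriNMF objective in the `U`-block: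
`U ↦ L₁·h₁(U,V) − f(U,V)` is convex, where `f(U,V) = (1/2)‖X − U V Uᵀ‖²` and
`h₁(U,V) = (a₁/4)‖V‖²‖U‖⁴ + (b₁/2)(‖X‖‖V‖ + ε₁)‖U‖²`. -/
theorem symTriNMF_block_relative_smooth_U {m r : ℕ}
    (X : Matrix (Fin m) (Fin m) ℝ) (hX : X.IsSymm)
    (a₁ b₁ ε₁ L₁ : ℝ) (ha₁ : 0 < a₁) (hb₁ : 0 < b₁) (hε₁ : 0 < ε₁)
    (hL₁ : max (6 / a₁) (2 / b₁) ≤ L₁)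
    (V : Matrix (Fin r) (Fin r) ℝ) :
    ConvexOn ℝ Set.univ (fun U : Matrix (Fin m) (Fin r) ℝ =>
      L₁ * (a₁ / 4 * fnorm V ^ 2 * fnorm U ^ 4
              + b₁ / 2 * (fnorm X * fnorm V + ε₁) * fnorm U ^ 2)
        - 1 / 2 * fnorm (X - U * V * Uᵀ) ^ 2) := by
  have hLa : 6 ≤ L₁ * a₁ := (div_le_iff₀ ha₁).1 ((le_max_left _ _).trans hL₁)
  have hLb : 2 ≤ L₁ * b₁ := (div_le_iff₀ hb₁).1 ((le_max_right _ _).trans hL₁)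
  set K := fnorm X * fnorm V + ε₁ with hK
  refine ⟨convex_univ, fun A _ B _ s t hs ht hst => ?_⟩
  set D := B - A with hD
  set R₀ := X - A * V * Aᵀ with hR₀
  set R₁ := D * V * Aᵀ + A * V * Dᵀ with hR₁
  set R₂ := D * V * Dᵀ with hR₂
  have hR (τ : ℝ) : X - (A + τ • D) * V * (A + τ • D)ᵀ = R₀ - τ • R₁ - τ ^ 2 • R₂ := by
    simp only [hR₀, hR₁, hR₂, transpose_add, transpose_smul, Matrix.add_mul, Matrix.mul_add,
      Matrix.smul_mul, Matrix.mul_smul]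
    module
  have hR' (τ : ℝ) : D * V * (A + τ • D)ᵀ + (A + τ • D) * V * Dᵀ = R₁ + (2 * τ) • R₂ := by
    simp only [hR₁, hR₂, transpose_add, transpose_smul, Matrix.add_mul, Matrix.mul_add,
      Matrix.smul_mul, Matrix.mul_smul]
    module
  have hN (τ : ℝ) : fnorm (A + τ • D) ^ 2
      = finner A A + 2 * finner A D * τ + finner D D * τ ^ 2 := by
    simp only [fnorm_sq, finner_add_left, finner_add_right, finner_smul_left, finner_smul_right,
      finner_comm D A]
    ring
  have hQ := convexOn_quartic
    (L₁ * (a₁ / 4 * fnorm V ^ 2 * finner A A ^ 2 + b₁ / 2 * K * finner A A)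
      - 1 / 2 * finner R₀ R₀)
    (L₁ * (a₁ / 4 * fnorm V ^ 2 * (4 * finner A A * finner A D) + b₁ / 2 * K * (2 * finner A D))
      + finner R₀ R₁)
    (L₁ * (a₁ / 4 * fnorm V ^ 2 * (4 * finner A D ^ 2 + 2 * finner A A * finner D D)
      + b₁ / 2 * K * finner D D) - 1 / 2 * (finner R₁ R₁ - 2 * finner R₀ R₂))
    (L₁ * (a₁ / 4 * fnorm V ^ 2 * (4 * finner A D * finner D D)) - finner R₁ R₂)
    (L₁ * (a₁ / 4 * fnorm V ^ 2 * finner D D ^ 2) - 1 / 2 * finner R₂ R₂) ?_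
  · have hF : ConvexOn ℝ Set.univ (fun τ : ℝ =>
        L₁ * (a₁ / 4 * fnorm V ^ 2 * fnorm (A + τ • D) ^ 4
          + b₁ / 2 * K * fnorm (A + τ • D) ^ 2)
          - 1 / 2 * fnorm (X - (A + τ • D) * V * (A + τ • D)ᵀ) ^ 2) := by
      convert hQ using 2 with τ
      rw [hR, show fnorm (A + τ • D) ^ 4 = (fnorm (A + τ • D) ^ 2) ^ 2 by ring, hN,
        fnorm_sq (R₀ - τ • R₁ - τ ^ 2 • R₂)]
      simp only [finner_sub_left, finner_sub_right, finner_smul_left, finner_smul_right,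
        finner_comm R₁ R₀, finner_comm R₂ R₀, finner_comm R₂ R₁]
      ring
    have h := hF.2 (Set.mem_univ 0) (Set.mem_univ 1) hs ht hst
    have e : s • A + t • B = A + t • D := by
      rw [hD, eq_sub_of_add_eq hst]
      module
    have e₁ : A + D = B := add_sub_cancel A B
    simpa only [e, smul_eq_mul, mul_zero, mul_one, zero_add, zero_smul, add_zero, one_smul, e₁]
      using h
  · intro τ
    have hv := second_variation_le X V (A + τ • D) D
    rw [hR, hR', ← hR₂, hN, fnorm_sq D] at hv
    simp only [finner_sub_left, finner_add_left, finner_add_right, finner_smul_left,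
      finner_smul_right, finner_comm R₂ R₁] at hv
    have hn : 0 ≤ finner A A + 2 * finner A D * τ + finner D D * τ ^ 2 := hN τ ▸ sq_nonneg _
    have hd := finner_self_nonneg D
    have hXV := mul_nonneg (fnorm_nonneg X) (fnorm_nonneg V)
    have p₁ := mul_nonneg (sub_nonneg.2 hLa) (mul_nonneg (mul_nonneg (sq_nonneg (fnorm V)) hn) hd)
    have p₂ := mul_nonneg (sub_nonneg.2 hLb) (mul_nonneg hXV hd)
    have p₃ := mul_nonneg (by linarith : 0 ≤ L₁ * b₁) (mul_nonneg hε₁.le hd)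
    have p₄ := mul_nonneg (by linarith : 0 ≤ L₁ * a₁)
      (sq_nonneg (fnorm V * (finner A D + finner D D * τ)))
    rw [hK]
    linarith
end

section
/- Let E = ℝ^{n_1} × ⋯ × ℝ^{n_N}, fix i ∈ {1,…,N} and x̄ ∈ E. Let h_i : E → ℝ be differentiable, i-th block convex (z ↦ h_i(x⟨i←z⟩) is convex for every x ∈ E), and i-th block 1-coercive (for every x ∈ E, h_i(x⟨i←z⟩)/‖z‖ → +∞ as ‖z‖ → ∞), and let g_i : ℝ^{n_i} → ℝ ∪ {+∞} be proper and lower semicontinuous. Then the following are equivalent: (a) there exists γ > 0 such that inf_{z ∈ ℝ^{n_i}} [ g_i(z) + (1/γ)·D_{h_i}(x̄⟨i←z⟩, x̄) ] > −∞; (b) there exists r ∈ ℝ such that z ↦ g_i(z) + r·h_i(x̄⟨i←z⟩) is bounded below on ℝ^{n_i}; (c) liminf_{‖z‖→∞} g_i(z)/h_i(x̄⟨i←z⟩) > −∞. -/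
open scoped RealInnerProductSpace
open Filter

/-- The `i`-th partial (block) gradient of `h` at `x`. -/
noncomputable def blockGrad {N : ℕ} {n : Fin N → ℕ}
    (h : ((i : Fin N) → EuclideanSpace ℝ (Fin (n i))) → ℝ)
    (i : Fin N) (x : (i : Fin N) → EuclideanSpace ℝ (Fin (n i))) :
    EuclideanSpace ℝ (Fin (n i)) :=
  gradient (fun z => h (Function.update x i z)) (x i)

/-- The `i`-th block Bregman distance `D_h(x⟨i←w⟩, x)`. -/
noncomputable def blockBreg {N : ℕ} {n : Fin N → ℕ}
    (h : ((i : Fin N) → EuclideanSpace ℝ (Fin (n i))) → ℝ)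
    (i : Fin N) (x : (i : Fin N) → EuclideanSpace ℝ (Fin (n i)))
    (w : EuclideanSpace ℝ (Fin (n i))) : ℝ :=
  h (Function.update x i w) - h x - ⟪blockGrad h i x, w - x i⟫

theorem EReal.coe_le_add_coe_iff (a : EReal) (M t : ℝ) :
    (M : EReal) ≤ a + (t : EReal) ↔ ((M - t : ℝ) : EReal) ≤ a := by
  rw [EReal.coe_sub]
  exact (EReal.sub_le_iff_le_add (Or.inl (EReal.coe_ne_bot t))
    (Or.inl (EReal.coe_ne_top t))).symm

/-- Boundedness below of `g + φ` passes to `g + ψ` when `φ ≤ ψ + C`. -/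
theorem exists_forall_le_add_of_le_add {F : Type*} {g : F → EReal} {φ ψ : F → ℝ} (C : ℝ)
    (hle : ∀ z, φ z ≤ ψ z + C)
    (hφ : ∃ M : ℝ, ∀ z, (M : EReal) ≤ g z + (φ z : EReal)) :
    ∃ M : ℝ, ∀ z, (M : EReal) ≤ g z + (ψ z : EReal) := by
  obtain ⟨M, hM⟩ := hφ
  refine ⟨M - C, fun z => ?_⟩
  rw [EReal.coe_le_add_coe_iff]
  refine le_trans ?_ ((EReal.coe_le_add_coe_iff _ _ _).1 (hM z))
  exact_mod_cast (by linarith [hle z] : M - C - ψ z ≤ M - φ z)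

/-- A continuous supercoercive function dominates every multiple of the norm, up to a constant. -/
theorem exists_mul_norm_le_add_of_tendsto_div_norm {F : Type*} [NormedAddCommGroup F]
    [ProperSpace F] {f : F → ℝ} (hf : Continuous f)
    (hcoer : Tendsto (fun z => f z / ‖z‖) (comap (fun z => ‖z‖) atTop) atTop) (K : ℝ) :
    ∃ C : ℝ, ∀ z, K * ‖z‖ ≤ f z + C := by
  have hev := (hcoer.eventually (eventually_ge_atTop K)).and
    (tendsto_comap.eventually (eventually_gt_atTop (0 : ℝ)))
  obtain ⟨R, -, hR⟩ := (atTop_basis.comap (fun z : F => ‖z‖)).eventually_iff.1 hev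
  obtain ⟨C, hC⟩ := (isCompact_closedBall (0 : F) R).bddAbove_image
    (f := fun z => K * ‖z‖ - f z) (by fun_prop)
  refine ⟨max C 0, fun z => ?_⟩
  rcases le_total ‖z‖ R with hz | hz
  · have := hC ⟨z, by simpa using hz, rfl⟩
    simp only at this
    linarith [le_max_left C 0]
  · obtain ⟨h1, h2⟩ := hR (show z ∈ (fun z : F => ‖z‖) ⁻¹' Set.Ici R from hz)
    rw [le_div_iff₀ h2] at h1
    linarith [le_max_right C 0]

/-- For `f` continuous and supercoercive, `g + r f` is bounded below for some `r` if and only if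
`g / f` has liminf greater than `⊥` at infinity. -/
theorem exists_bddBelow_add_mul_iff_bot_lt_liminf_div {F : Type*} [NormedAddCommGroup F]
    [ProperSpace F] {f : F → ℝ} (hf : Continuous f)
    (hcoer : Tendsto (fun z => f z / ‖z‖) (comap (fun z => ‖z‖) atTop) atTop)
    {g : F → EReal} (hbot : ∀ z, g z ≠ ⊥) (hlsc : LowerSemicontinuous g) :
    (∃ r : ℝ, ∃ M : ℝ, ∀ z, (M : EReal) ≤ g z + ((r * f z : ℝ) : EReal)) ↔
      ⊥ < liminf (fun z => g z / (f z : EReal)) (comap (fun z => ‖z‖) atTop) := by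
  have hev : ∀ᶠ z in comap (fun z : F => ‖z‖) atTop, 1 ≤ f z := by
    obtain ⟨C, hC⟩ := exists_mul_norm_le_add_of_tendsto_div_norm hf hcoer 1
    filter_upwards [tendsto_comap.eventually (eventually_ge_atTop (1 + C))] with z hz
    linarith [hC z]
  constructor
  · rintro ⟨r, M, hM⟩
    refine (EReal.bot_lt_coe (-|M| - r)).trans_le (le_liminf_of_le ?_ ?_)
    · isBoundedDefault
    filter_upwards [hev] with z hz
    rw [EReal.le_div_iff_mul_le (by exact_mod_cast (by linarith : (0 : ℝ) < f z))
      (EReal.coe_ne_top _)]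
    refine le_trans ?_ ((EReal.coe_le_add_coe_iff _ _ _).1 (hM z))
    exact_mod_cast (by nlinarith [neg_abs_le M, abs_nonneg M] :
      (-|M| - r) * f z ≤ M - r * f z)
  · intro hlim
    obtain ⟨c, -, hc⟩ := EReal.lt_iff_exists_real_btwn.1 hlim
    have hev' := (eventually_lt_of_lt_liminf hc).and hev
    obtain ⟨R, -, hR⟩ := (atTop_basis.comap (fun z : F => ‖z‖)).eventually_iff.1 hev'
    obtain ⟨B, hB⟩ := (isCompact_closedBall (0 : F) R).bddBelow_image
      (f := fun z => -c * f z) (by fun_prop)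
    obtain ⟨m, hm⟩ : ∃ m : ℝ, ∀ z ∈ Metric.closedBall (0 : F) R, (m : EReal) ≤ g z := by
      rcases (Metric.closedBall (0 : F) R).eq_empty_or_nonempty with he | hne
      · exact ⟨0, by simp [he]⟩
      · obtain ⟨a, -, ha⟩ := (hlsc.lowerSemicontinuousOn _).exists_isMinOn hne
          (isCompact_closedBall (0 : F) R)
        obtain ⟨m, -, hm⟩ := EReal.lt_iff_exists_real_btwn.1 (bot_lt_iff_ne_bot.2 (hbot a))
        exact ⟨m, fun z hz => hm.le.trans (ha hz)⟩
    refine ⟨-c, min 0 (m + B), fun z => ?_⟩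
    rw [EReal.coe_le_add_coe_iff]
    rcases le_total ‖z‖ R with hz | hz
    · have hz' : z ∈ Metric.closedBall (0 : F) R := by simpa using hz
      have := hB ⟨z, hz', rfl⟩
      simp only at this
      refine le_trans ?_ (hm z hz')
      exact_mod_cast (by linarith [min_le_right 0 (m + B)] :
        min 0 (m + B) - -c * f z ≤ m)
    · obtain ⟨h1, h2⟩ := hR (show z ∈ (fun z : F => ‖z‖) ⁻¹' Set.Ici R from hz)
      have h3 := (EReal.le_div_iff_mul_le
        (by exact_mod_cast (by linarith : (0 : ℝ) < f z)) (EReal.coe_ne_top _)).1 h1.le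
      refine le_trans ?_ h3
      exact_mod_cast (by linarith [min_le_left 0 (m + B)] :
        min 0 (m + B) - -c * f z ≤ c * f z)

/-- For `f` continuous and supercoercive, adding an affine function `⟪v, z - x⟫ + a` to `f` does not
affect whether some multiple of it makes `g` bounded below. -/
theorem exists_pos_bddBelow_add_sub_inner_iff {F : Type*} [NormedAddCommGroup F]
    [InnerProductSpace ℝ F] [ProperSpace F] {f : F → ℝ} (hf : Continuous f)
    (hcoer : Tendsto (fun z => f z / ‖z‖) (comap (fun z => ‖z‖) atTop) atTop)
    (g : F → EReal) (a : ℝ) (v x : F) :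
    (∃ γ : ℝ, 0 < γ ∧ ∃ M : ℝ, ∀ z,
        (M : EReal) ≤ g z + ((1 / γ * (f z - a - ⟪v, z - x⟫) : ℝ) : EReal)) ↔
      ∃ r : ℝ, ∃ M : ℝ, ∀ z, (M : EReal) ≤ g z + ((r * f z : ℝ) : EReal) := by
  have hinner : ∀ z, |⟪v, z - x⟫| ≤ ‖v‖ * ‖z‖ + ‖v‖ * ‖x‖ := fun z => by
    calc |⟪v, z - x⟫| ≤ ‖v‖ * ‖z - x‖ := abs_real_inner_le_norm _ _
      _ ≤ ‖v‖ * (‖z‖ + ‖x‖) := by gcongr; exact norm_sub_le z x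
      _ = _ := by ring
  obtain ⟨C, hC⟩ := exists_mul_norm_le_add_of_tendsto_div_norm hf hcoer (2 * ‖v‖)
  obtain ⟨B, hB⟩ := exists_mul_norm_le_add_of_tendsto_div_norm hf hcoer 0
  constructor
  · rintro ⟨γ, hγ, hM⟩
    refine ⟨1 / γ * (3 / 2), exists_forall_le_add_of_le_add
      (1 / γ * (C / 2 + ‖v‖ * ‖x‖ - a)) (fun z => ?_) hM⟩
    rw [mul_assoc, ← mul_add]
    gcongr
    linarith [hC z, hinner z, neg_abs_le ⟪v, z - x⟫]
  · rintro ⟨r, hM⟩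
    have hs : 0 < max r 1 := lt_max_of_lt_right one_pos
    refine ⟨1 / (2 * max r 1), by positivity, exists_forall_le_add_of_le_add
      ((max r 1 - r) * B + max r 1 * (C + 2 * (‖v‖ * ‖x‖) + 2 * a)) (fun z => ?_) hM⟩
    have h1 : 0 ≤ (max r 1 - r) * (f z + B) :=
      mul_nonneg (by linarith [le_max_left r 1]) (by linarith [hB z])
    have h2 : max r 1 * f z ≤ max r 1 *
        (2 * (f z - a - ⟪v, z - x⟫) + (C + 2 * (‖v‖ * ‖x‖) + 2 * a)) := by
      gcongr
      linarith [hC z, hinner z, le_abs_self ⟪v, z - x⟫]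
    rw [one_div_one_div]
    linarith

/-- Characterizations of block prox-boundedness. -/
theorem block_prox_boundedness_characterization
    {N : ℕ} {n : Fin N → ℕ} (i : Fin N)
    (xbar : (i : Fin N) → EuclideanSpace ℝ (Fin (n i)))
    (h : ((i : Fin N) → EuclideanSpace ℝ (Fin (n i))) → ℝ)
    (hdiff : Differentiable ℝ h)
    (hconv : ∀ x, ConvexOn ℝ Set.univ (fun z : EuclideanSpace ℝ (Fin (n i)) =>
      h (Function.update x i z)))
    (hcoer : ∀ x, Tendsto
      (fun z : EuclideanSpace ℝ (Fin (n i)) => h (Function.update x i z) / ‖z‖)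
      (comap (fun z => ‖z‖) atTop) atTop)
    (g : EuclideanSpace ℝ (Fin (n i)) → EReal)
    (hgproper : ∃ z, g z ≠ ⊤) (hgreal : ∀ z, g z ≠ ⊥)
    (hglsc : LowerSemicontinuous g) :
    ((∃ γ : ℝ, 0 < γ ∧ ∃ M : ℝ, ∀ z,
        (M : EReal) ≤ g z + ((1 / γ * blockBreg h i xbar z : ℝ) : EReal))
      ↔ (∃ r : ℝ, ∃ M : ℝ, ∀ z,
        (M : EReal) ≤ g z + ((r * h (Function.update xbar i z) : ℝ) : EReal))) ∧
    ((∃ γ : ℝ, 0 < γ ∧ ∃ M : ℝ, ∀ z,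
        (M : EReal) ≤ g z + ((1 / γ * blockBreg h i xbar z : ℝ) : EReal))
      ↔ ⊥ < Filter.liminf
          (fun z => g z / ((h (Function.update xbar i z) : ℝ) : EReal))
          (comap (fun z => ‖z‖) atTop)) := by
  have hf : Continuous fun z => h (Function.update xbar i z) :=
    hdiff.continuous.comp (continuous_const.update i continuous_id)
  have hab := exists_pos_bddBelow_add_sub_inner_iff hf (hcoer xbar) g (h xbar)
    (blockGrad h i xbar) (xbar i)
  exact ⟨hab, hab.trans
    (exists_bddBelow_add_mul_iff_bot_lt_liminf_div hf (hcoer xbar) hgreal hglsc)⟩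
end

section
/- Let (s_k)_{k∈ℕ} be a non-increasing sequence of nonnegative real numbers, let θ ∈ [0,1) and β > 0, and assume s_k^{2θ} ≤ β(s_k − s_{k+1}) for every k with s_k > 0. Then: (1) if θ = 0, the sequence (s_k) reaches 0 in finitely many steps; (2) if θ ∈ (0, 1/2], there exist λ > 0 and τ ∈ [0,1) such that 0 ≤ s_k ≤ λ·τ^k for every k ∈ ℕ; (3) if θ ∈ (1/2, 1), there exists μ > 0 such that 0 ≤ s_k ≤ μ·k^{−1/(2θ−1)} for every k ≥ 1. -/
/-- The tangent line of the convex function `t ↦ t ^ (-p)` at `x` lies below its graph. -/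
theorem Real.mul_rpow_sub_le_rpow_neg_sub_rpow_neg {x y p : ℝ} (hx : 0 < x) (hy : 0 < y)
    (hp : 0 < p) : p * (x ^ (-(p + 1)) * (x - y)) ≤ y ^ (-p) - x ^ (-p) := by
  have hb : 1 + (-p) * (y / x - 1) ≤ (y / x) ^ (-p) := by
    have hexp := Real.add_one_le_exp (Real.log (y / x) * -p)
    have hlog := mul_le_mul_of_nonneg_left (Real.log_le_sub_one_of_pos (div_pos hy hx)) hp.le
    rw [Real.rpow_def_of_pos (div_pos hy hx)]
    linarith
  rw [Real.div_rpow hy.le hx.le, le_div_iff₀ (Real.rpow_pos_of_pos hx _)] at hb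
  have hxp : x ^ (-(p + 1)) = x ^ (-p) / x := by
    rw [show -(p + 1) = -p - 1 by ring, Real.rpow_sub_one hx.ne']
  have h : p * (x ^ (-p) / x * (x - y)) = (1 + (-p) * (y / x - 1)) * x ^ (-p) - x ^ (-p) := by
    field_simp
    ring
  rw [hxp, h]
  linarith

/-- A nonnegative sequence that decreases by at least `δ > 0` as long as it is positive
vanishes at some index. -/
theorem exists_eq_zero_of_le_sub {s : ℕ → ℝ} {δ : ℝ} (hpos : ∀ k, 0 ≤ s k) (hδ : 0 < δ)
    (h : ∀ k, 0 < s k → δ ≤ s k - s (k + 1)) : ∃ K, s K = 0 := by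
  by_contra! hne
  have hle : ∀ k : ℕ, s k ≤ s 0 - k * δ := by
    intro k
    induction k with
    | zero => simp
    | succ k ih =>
      have := h k ((hpos k).lt_of_ne' (hne k))
      push_cast
      linarith
  obtain ⟨n, hn⟩ := exists_nat_gt (s 0 / δ)
  rw [div_lt_iff₀ hδ] at hn
  linarith [hle n, hpos n]

/-- If `s k ^ (1 + p) ≤ β * (s k - s (k + 1))` while `s k > 0`, then `s k ^ (-p)` grows at least
linearly as long as `s` is positive. -/
theorem mul_le_rpow_neg_of_rpow_le {s : ℕ → ℝ} {p β : ℝ} (hmono : Antitone s) (hp : 0 < p)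
    (hβ : 0 < β) (hrec : ∀ k, 0 < s k → s k ^ (p + 1) ≤ β * (s k - s (k + 1))) (k : ℕ)
    (hk : 0 < s k) : p / β * k ≤ s k ^ (-p) := by
  induction k with
  | zero => simpa using (Real.rpow_pos_of_pos hk (-p)).le
  | succ k ih =>
    have hk' : 0 < s k := hk.trans_le (hmono k.le_succ)
    have htan := Real.mul_rpow_sub_le_rpow_neg_sub_rpow_neg hk' hk hp
    have hstep : 1 / β ≤ s k ^ (-(p + 1)) * (s k - s (k + 1)) := by
      rw [Real.rpow_neg hk'.le, inv_mul_eq_div, div_le_div_iff₀ hβ (Real.rpow_pos_of_pos hk' _)]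
      linarith [hrec k hk']
    have hmul := mul_le_mul_of_nonneg_left hstep hp.le
    rw [mul_one_div] at hmul
    push_cast
    linarith [ih hk']


/-- Convergence rates of a nonnegative non-increasing sequence satisfying
`s_k^{2θ} ≤ β (s_k − s_{k+1})`. -/
theorem rate_of_nonneg_sequence (s : ℕ → ℝ) (θ β : ℝ)
    (hmono : ∀ k, s (k + 1) ≤ s k) (hpos : ∀ k, 0 ≤ s k)
    (hθ0 : 0 ≤ θ) (hθ1 : θ < 1) (hβ : 0 < β)
    (hrec : ∀ k, 0 < s k → s k ^ (2 * θ) ≤ β * (s k - s (k + 1))) :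
    (θ = 0 → ∃ K : ℕ, ∀ k, K ≤ k → s k = 0) ∧
    (0 < θ → θ ≤ 1 / 2 →
      ∃ lam : ℝ, 0 < lam ∧ ∃ τ : ℝ, 0 ≤ τ ∧ τ < 1 ∧
        ∀ k : ℕ, s k ≤ lam * τ ^ k) ∧
    (1 / 2 < θ →
      ∃ μ : ℝ, 0 < μ ∧ ∀ k : ℕ, 1 ≤ k →
        s k ≤ μ * (k : ℝ) ^ (-(1 / (2 * θ - 1)))) := by
  have hanti : Antitone s := antitone_nat_of_succ_le hmono
  refine ⟨fun hθ => ?_, fun _ hθ => ?_, fun hθ => ?_⟩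
  · obtain ⟨K, hK⟩ := exists_eq_zero_of_le_sub (δ := 1 / β) hpos (by positivity) fun k hk => by
      have := hrec k hk
      rw [hθ, mul_zero, Real.rpow_zero] at this
      rwa [div_le_iff₀' hβ]
    exact ⟨K, fun k hk => le_antisymm (hK ▸ hanti hk) (hpos k)⟩
  · rcases (hpos 0).eq_or_lt with h0 | h0
    · refine ⟨1, one_pos, 0, le_rfl, one_pos, fun k => ?_⟩
      have : s k ≤ 0 := h0 ▸ hanti k.zero_le
      exact this.trans (by positivity)
    · set c := s 0 ^ (2 * θ - 1)
      have hcpos : 0 < c := Real.rpow_pos_of_pos h0 _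
      refine ⟨s 0, h0, max 0 (1 - c / β), le_max_left _ _,
        max_lt one_pos (by linarith [div_pos hcpos hβ]), fun k => ?_⟩
      induction k with
      | zero => simp
      | succ k ih =>
        have hstep : s (k + 1) ≤ s k * (1 - c / β) := by
          rcases (hpos k).eq_or_lt with hk | hk
          · have := hmono k
            rw [← hk] at this ⊢
            linarith
          · have hle : c ≤ s k ^ (2 * θ - 1) :=
              Real.rpow_le_rpow_of_nonpos hk (hanti k.zero_le) (by linarith)
            have hck : s k * c ≤ β * (s k - s (k + 1)) := by
              refine (mul_le_mul_of_nonneg_left hle hk.le).trans ?_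
              rw [Real.rpow_sub_one hk.ne', mul_div_cancel₀ _ hk.ne']
              exact hrec k hk
            rw [← div_le_iff₀' hβ, mul_div_assoc] at hck
            linarith
        calc s (k + 1) ≤ s k * max 0 (1 - c / β) :=
              hstep.trans (mul_le_mul_of_nonneg_left (le_max_right _ _) (hpos k))
          _ ≤ s 0 * max 0 (1 - c / β) ^ k * max 0 (1 - c / β) :=
              mul_le_mul_of_nonneg_right ih (le_max_left _ _)
          _ = s 0 * max 0 (1 - c / β) ^ (k + 1) := by ring
  · have hp : 0 < 2 * θ - 1 := by linarith
    have hr : 0 < (2 * θ - 1) / β := div_pos hp hβ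
    refine ⟨((2 * θ - 1) / β) ^ (-(1 / (2 * θ - 1))), Real.rpow_pos_of_pos hr _, fun k hk1 => ?_⟩
    have hk0 : (0 : ℝ) < k := by exact_mod_cast hk1
    rcases (hpos k).eq_or_lt with hk | hk
    · rw [← hk]
      positivity
    · have hlin := mul_le_rpow_neg_of_rpow_le hanti hp hβ (by simpa using hrec) k hk
      rw [← Real.mul_rpow hr.le hk0.le]
      have hinv : (s k ^ (-(2 * θ - 1))) ^ (-(1 / (2 * θ - 1))) = s k := by
        rw [← Real.rpow_mul hk.le, neg_mul_neg, mul_one_div_cancel hp.ne', Real.rpow_one]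
      rw [← hinv]
      exact Real.rpow_le_rpow_of_nonpos (mul_pos hr hk0) hlin
        (neg_nonpos.2 (one_div_pos.2 hp).le)
end
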